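/- arXiv:1201.5084 — 2 statements merged into one kernel-verified Lean document; each statement's English description precedes it below -/
import Mathlib

section
/- For every H in (1/2, 1) and all s, t ≥ 0, the unified triple-integral form of the oscillatory sub-fractional Brownian motion covariance holds: ∫_0^t ∫_0^s ∫_0^{u∧v} Σ_{j∈ℤ} e^{-b a^j (u+v-2r)} (b a^j)^{3-2H} dr du dv = Q_H(s,t), where Q_H(s,t) = s^{2H} h_s + t^{2H} h_t - (1/2)[(s+t)^{2H} h_{s+t} + |s-t|^{2H} h_{|s-t|}]. -/
open Real

/-- The oscillatory function `h_t = Σ_{j∈ℤ} (b a^j t)^{-2H} (e^{-b a^j t} - 1 + b a^j t)`. -/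
noncomputable def hosc (a b H t : ℝ) : ℝ :=
  ∑' j : ℤ, (b * a ^ j * t) ^ (-(2 * H)) *
    (Real.exp (-(b * a ^ j * t)) - 1 + b * a ^ j * t)

/-- The oscillatory sub-fractional Brownian motion covariance `Q_H(s,t)`. -/
noncomputable def Qcov (a b H s t : ℝ) : ℝ :=
  s ^ (2 * H) * hosc a b H s + t ^ (2 * H) * hosc a b H t
    - (1 / 2) * ((s + t) ^ (2 * H) * hosc a b H (s + t)
      + |s - t| ^ (2 * H) * hosc a b H |s - t|)

open MeasureTheory in
lemma aux_swap (x : ℝ) (hx : 0 ≤ x) (F : ℤ → ℝ → ℝ) (hc : ∀ j, Continuous (F j))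
    (h0 : ∀ j, ∀ y, 0 < y → y ≤ x → 0 ≤ F j y)
    (hs : Summable fun j => ∫ y in (0:ℝ)..x, F j y) :
    (∫ y in (0:ℝ)..x, ∑' j, F j y) = ∑' j, ∫ y in (0:ℝ)..x, F j y := by
  simp only [intervalIntegral.integral_of_le hx] at hs ⊢
  refine (hasSum_integral_of_summable_integral_norm (F := F)
    (μ := volume.restrict (Set.Ioc 0 x)) ?_ ?_).tsum_eq.symm
  · intro j
    exact ((hc j).integrableOn_Icc (a := 0) (b := x)).mono_set Set.Ioc_subset_Icc_self
  · refine hs.congr fun j => ?_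
    refine setIntegral_congr_fun measurableSet_Ioc fun y hy => ?_
    simp only [Real.norm_eq_abs]
    rw [abs_of_nonneg (h0 j y hy.1 hy.2)]

lemma aux_summable (a b H : ℝ) (ha0 : 0 < a) (ha1 : a < 1) (hb : 0 < b)
    (hH1 : 1 / 2 < H) (hH2 : H < 1) (C : ℝ) (f : ℤ → ℝ) (h0 : ∀ j, 0 ≤ f j)
    (h1 : ∀ j, f j ≤ C * (b * a ^ j) ^ (2 - 2 * H))
    (h2 : ∀ j, f j ≤ C * (b * a ^ j) ^ (1 - 2 * H)) : Summable f := by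
  apply Summable.of_nat_of_neg
  · refine Summable.of_nonneg_of_le (fun n => h0 _) (fun n => h1 _) ?_
    have : ∀ n : ℕ, C * (b * a ^ (n:ℤ)) ^ (2 - 2 * H)
        = C * b ^ (2 - 2 * H) * (a ^ (2 - 2 * H)) ^ n := by
      intro n
      rw [Real.mul_rpow hb.le (by positivity), zpow_natCast, ← Real.rpow_natCast,
        ← Real.rpow_natCast, ← Real.rpow_mul ha0.le, ← Real.rpow_mul ha0.le, mul_comm (n:ℝ)]
      ring
    simp only [this]
    exact (summable_geometric_of_lt_one (by positivity)
      (Real.rpow_lt_one ha0.le ha1 (by linarith))).mul_left _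
  · refine Summable.of_nonneg_of_le (fun n => h0 _) (fun n => h2 _) ?_
    have : ∀ n : ℕ, C * (b * a ^ (-(n:ℤ))) ^ (1 - 2 * H)
        = C * b ^ (1 - 2 * H) * (a ^ (2 * H - 1)) ^ n := by
      intro n
      rw [Real.mul_rpow hb.le (by positivity), zpow_neg, zpow_natCast, ← Real.rpow_natCast,
        ← Real.rpow_natCast, ← Real.rpow_neg ha0.le, ← Real.rpow_mul ha0.le,
        ← Real.rpow_mul ha0.le]
      rw [show -(n:ℝ) * (1 - 2 * H) = (2 * H - 1) * n by ring]
      ring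
    simp only [this]
    exact (summable_geometric_of_lt_one (by positivity)
      (Real.rpow_lt_one ha0.le ha1 (by linarith))).mul_left _

noncomputable def psiA (l x : ℝ) : ℝ := ∫ y in (0:ℝ)..x, Real.exp (-(l * |y|))
noncomputable def PhiA (l x : ℝ) : ℝ := ∫ y in (0:ℝ)..x, psiA l y

lemma psiA_deriv (l x : ℝ) : HasDerivAt (psiA l) (Real.exp (-(l * |x|))) x := by
  have hc : Continuous fun y : ℝ => Real.exp (-(l * |y|)) := by fun_prop
  exact hc.integral_hasStrictDerivAt 0 x |>.hasDerivAt

lemma psiA_cont (l : ℝ) : Continuous (psiA l) :=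
  continuous_iff_continuousAt.2 fun x => (psiA_deriv l x).continuousAt

lemma PhiA_deriv (l x : ℝ) : HasDerivAt (PhiA l) (psiA l x) x :=
  (psiA_cont l).integral_hasStrictDerivAt 0 x |>.hasDerivAt

lemma psiA_neg (l x : ℝ) : psiA l (-x) = - psiA l x := by
  have := intervalIntegral.integral_comp_neg (a := 0) (b := x)
    (fun y : ℝ => Real.exp (-(l * |y|)))
  simp only [abs_neg, neg_zero] at this
  rw [psiA, psiA, this, intervalIntegral.integral_symm]

lemma PhiA_neg (l x : ℝ) : PhiA l (-x) = PhiA l x := by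
  have := intervalIntegral.integral_comp_neg (a := 0) (b := x) (psiA l)
  simp only [psiA_neg, neg_zero, intervalIntegral.integral_neg] at this
  rw [PhiA, PhiA, intervalIntegral.integral_symm, ← this, neg_neg]

lemma PhiA_abs (l x : ℝ) : PhiA l |x| = PhiA l x := by
  rcases abs_cases x with h | h <;> rw [h.1]
  exact PhiA_neg l x

lemma exp_deriv_aux (l : ℝ) (x : ℝ) :
    HasDerivAt (fun y => Real.exp (-(l * y))) (-l * Real.exp (-(l * x))) x := by
  have h := ((hasDerivAt_id x).const_mul l).fun_neg.exp
  simp only [id, mul_one] at h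
  convert h using 1
  ring

lemma int_exp (l : ℝ) (hl : 0 < l) (x : ℝ) :
    ∫ y in (0:ℝ)..x, Real.exp (-(l * y)) = (1 - Real.exp (-(l * x))) / l := by
  rw [intervalIntegral.integral_eq_sub_of_hasDerivAt
    (f := fun y => -(Real.exp (-(l * y)) / l))]
  · simp; field_simp; ring
  · intro y _
    have := ((exp_deriv_aux l y).div_const l).fun_neg
    convert this using 1
    field_simp
  · exact Continuous.intervalIntegrable (by fun_prop) _ _

lemma psiA_nonneg_eq (l : ℝ) (hl : 0 < l) (x : ℝ) (hx : 0 ≤ x) :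
    psiA l x = (1 - Real.exp (-(l * x))) / l := by
  rw [← int_exp l hl, psiA]
  refine intervalIntegral.integral_congr fun y hy => ?_
  rw [Set.uIcc_of_le hx] at hy
  simp only [abs_of_nonneg hy.1]

lemma psiA_le (l : ℝ) (hl : 0 < l) (x : ℝ) : psiA l x ≤ 1 / l := by
  rcases le_total 0 x with h | h
  · rw [psiA_nonneg_eq l hl x h]
    gcongr
    linarith [Real.exp_pos (-(l * x))]
  · have h1 := psiA_nonneg_eq l hl (-x) (by linarith)
    rw [psiA_neg] at h1
    have : 0 ≤ (1 - Real.exp (-(l * -x))) / l := by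
      apply div_nonneg _ hl.le
      have : Real.exp (-(l * -x)) ≤ 1 := by
        rw [Real.exp_le_one_iff]; nlinarith
      linarith
    have : 0 < 1 / l := by positivity
    linarith

lemma PhiA_nonneg_eq (l : ℝ) (hl : 0 < l) (x : ℝ) (hx : 0 ≤ x) :
    PhiA l x = (Real.exp (-(l * x)) - 1 + l * x) / l ^ 2 := by
  have : PhiA l x = ∫ y in (0:ℝ)..x, (1 - Real.exp (-(l * y))) / l := by
    refine intervalIntegral.integral_congr fun y hy => ?_
    rw [Set.uIcc_of_le hx] at hy
    exact psiA_nonneg_eq l hl y hy.1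
  rw [this, intervalIntegral.integral_div, intervalIntegral.integral_sub, int_exp l hl]
  · simp; field_simp; ring
  · simp
  · exact Continuous.intervalIntegrable (by fun_prop) _ _

/-- level-1 value (without power factor) -/
lemma int1 (l : ℝ) (hl : 0 < l) (u v : ℝ) :
    ∫ r in (0:ℝ)..(min u v), Real.exp (-(l * (u + v - 2 * r)))
      = (Real.exp (-(l * |u - v|)) - Real.exp (-(l * (u + v)))) / (2 * l) := by
  have hm : u + v - 2 * min u v = |u - v| := by
    rcases le_total u v with h | h
    · rw [min_eq_left h, abs_of_nonpos (by linarith)]; ring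
    · rw [min_eq_right h, abs_of_nonneg (by linarith)]; ring
  rw [intervalIntegral.integral_eq_sub_of_hasDerivAt
    (f := fun r => Real.exp (-(l * (u + v - 2 * r))) / (2 * l))]
  · rw [hm]; simp; ring
  · intro y _
    have h := ((((hasDerivAt_id y).const_mul 2).const_sub (u + v)).const_mul l).fun_neg.exp.div_const
      (2 * l)
    simp only [id] at h
    have e : Real.exp (-(l * (u + v - 2 * y))) * -(l * -(2 * 1)) / (2 * l)
        = Real.exp (-(l * (u + v - 2 * y))) := by
      rw [div_eq_iff (by positivity)]
      ring
    rw [e] at h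
    exact h
  · exact Continuous.intervalIntegrable (by fun_prop) _ _

lemma int2 (l : ℝ) (hl : 0 < l) (s v : ℝ) :
    ∫ u in (0:ℝ)..s, (Real.exp (-(l * |u - v|)) - Real.exp (-(l * (u + v))))
      = psiA l (s - v) + psiA l v - Real.exp (-(l * v)) * ((1 - Real.exp (-(l * s))) / l) := by
  rw [intervalIntegral.integral_sub]
  · congr 1
    · rw [intervalIntegral.integral_eq_sub_of_hasDerivAt (f := fun u => psiA l (u - v))]
      · simp [psiA_neg]
      · intro y _
        exact (psiA_deriv l (y - v)).comp_sub_const y v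
      · exact Continuous.intervalIntegrable (by fun_prop) _ _
    · rw [← int_exp l hl, ← intervalIntegral.integral_const_mul]
      refine intervalIntegral.integral_congr fun y hy => ?_
      simp only [← Real.exp_add]
      congr 1; ring
  · exact Continuous.intervalIntegrable (by fun_prop) _ _
  · exact Continuous.intervalIntegrable (by fun_prop) _ _

lemma int3 (l : ℝ) (hl : 0 < l) (s t : ℝ) :
    ∫ v in (0:ℝ)..t,
      (psiA l (s - v) + psiA l v - Real.exp (-(l * v)) * ((1 - Real.exp (-(l * s))) / l))
      = PhiA l s - PhiA l (s - t) + PhiA l t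
        - ((1 - Real.exp (-(l * t))) / l) * ((1 - Real.exp (-(l * s))) / l) := by
  have hp := psiA_cont l
  rw [intervalIntegral.integral_sub, intervalIntegral.integral_add,
    intervalIntegral.integral_mul_const, int_exp l hl]
  · congr 2
    rw [intervalIntegral.integral_eq_sub_of_hasDerivAt (f := fun u => -PhiA l (s - u))]
    · simp; ring
    · intro y _
      have := ((PhiA_deriv l (s - y)).comp_const_sub s y).fun_neg
      simpa using this
    · exact Continuous.intervalIntegrable (by fun_prop) _ _
  all_goals exact Continuous.intervalIntegrable (by fun_prop) _ _

lemma G_nonneg (l : ℝ) (hl : 0 < l) (u v : ℝ) (hu : 0 ≤ u) (hv : 0 ≤ v) :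
    0 ≤ Real.exp (-(l * |u - v|)) - Real.exp (-(l * (u + v))) := by
  rw [sub_nonneg, Real.exp_le_exp, neg_le_neg_iff]
  apply mul_le_mul_of_nonneg_left _ hl.le
  rw [abs_le]; constructor <;> linarith

lemma exp_le_inv_aux (x : ℝ) (hx : 0 < x) : Real.exp (-x) ≤ 1 / x := by
  rw [Real.exp_neg, ← one_div]
  apply one_div_le_one_div_of_le hx
  linarith [Real.add_one_le_exp x]

lemma phi_le_sq (x : ℝ) (hx : 0 ≤ x) : Real.exp (-x) - 1 + x ≤ x ^ 2 := by
  have : Real.exp (-x) ≤ 1 / (1 + x) := by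
    rw [Real.exp_neg, ← one_div]
    apply one_div_le_one_div_of_le (by linarith)
    linarith [Real.add_one_le_exp x]
  have h2 : 1 / (1 + x) ≤ 1 - x + x ^ 2 := by
    rw [div_le_iff₀ (by linarith)]
    nlinarith [pow_nonneg hx 3]
  linarith

lemma hosc_sum (a b H : ℝ) (ha0 : 0 < a) (ha1 : a < 1) (hb : 0 < b)
    (hH1 : 1 / 2 < H) (hH2 : H < 1) (t : ℝ) (ht : 0 ≤ t) :
    HasSum (fun j : ℤ => (b * a ^ j) ^ (2 - 2 * H) * PhiA (b * a ^ j) t)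
      (t ^ (2 * H) * hosc a b H t) := by
  have hl : ∀ j : ℤ, 0 < b * a ^ j := fun j => by positivity
  have key : ∀ j : ℤ, (b * a ^ j) ^ (2 - 2 * H) * PhiA (b * a ^ j) t
      = t ^ (2 * H) * ((b * a ^ j * t) ^ (-(2 * H)) *
    (Real.exp (-(b * a ^ j * t)) - 1 + b * a ^ j * t)) := by
    intro j
    have hlj := hl j
    rw [PhiA_nonneg_eq _ hlj t ht]
    generalize b * a ^ j = l at hlj
    rcases ht.eq_or_lt with h | h
    · subst h; simp
    · rw [Real.mul_rpow hlj.le ht, Real.rpow_sub hlj, Real.rpow_neg hlj.le, Real.rpow_neg ht]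
      have h1 := (Real.rpow_pos_of_pos h (2 * H)).ne'
      have h2 := (Real.rpow_pos_of_pos hlj (2 * H)).ne'
      rw [Real.rpow_two]
      field_simp
  have hsum : Summable (fun j : ℤ => (b * a ^ j) ^ (2 - 2 * H) * PhiA (b * a ^ j) t) := by
    apply aux_summable a b H ha0 ha1 hb hH1 hH2 (t ^ 2 + t)
    · intro j
      rw [PhiA_nonneg_eq _ (hl j) t ht]
      have := Real.add_one_le_exp (-(b * a ^ j * t))
      have h3 : 0 ≤ Real.exp (-(b * a ^ j * t)) - 1 + b * a ^ j * t := by linarith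
      have := hl j
      positivity
    · intro j
      have hlj := hl j
      rw [PhiA_nonneg_eq _ (hl j) t ht]
      generalize b * a ^ j = l at hlj
      rw [mul_comm]
      apply mul_le_mul_of_nonneg_right _ (by positivity)
      rw [div_le_iff₀ (by positivity)]
      have := phi_le_sq (l * t) (by positivity)
      nlinarith [mul_nonneg ht (sq_nonneg l)]
    · intro j
      have hlj := hl j
      rw [PhiA_nonneg_eq _ (hl j) t ht]
      generalize b * a ^ j = l at hlj
      rw [show 2 - 2 * H = (1 - 2 * H) + 1 by ring, Real.rpow_add_one hlj.ne', mul_assoc, mul_comm]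
      apply mul_le_mul_of_nonneg_right _ (by positivity)
      rw [← mul_div_assoc, div_le_iff₀ (by positivity)]
      have h4 : Real.exp (-(l * t)) ≤ 1 := by
        rw [Real.exp_le_one_iff]; nlinarith
      have h5 : l * (Real.exp (-(l * t)) - 1 + l * t) ≤ l * (l * t) := by
        apply mul_le_mul_of_nonneg_left _ hlj.le
        linarith
      nlinarith [mul_nonneg (sq_nonneg t) (sq_nonneg l)]
  have := hsum.hasSum
  convert this using 1
  rw [hosc, ← tsum_mul_left]
  exact tsum_congr fun j => (key j).symm

theorem stmt4 (a b : ℝ) (ha0 : 0 < a) (ha1 : a < 1) (hb : 0 < b)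
    (H : ℝ) (hH1 : 1 / 2 < H) (hH2 : H < 1) (s t : ℝ) (hs : 0 ≤ s) (ht : 0 ≤ t) :
    (∫ v in (0:ℝ)..t, ∫ u in (0:ℝ)..s, ∫ r in (0:ℝ)..(min u v),
      ∑' j : ℤ, Real.exp (-(b * a ^ j * (u + v - 2 * r))) * (b * a ^ j) ^ (3 - 2 * H))
    = Qcov a b H s t := by
  have hl : ∀ j : ℤ, 0 < b * a ^ j := fun j => by positivity
  have hpow3 : ∀ l : ℝ, 0 < l → l ^ (3 - 2 * H) = l ^ (2 - 2 * H) * l := by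
    intro l hl
    rw [show 3 - 2 * H = (2 - 2 * H) + 1 by ring, Real.rpow_add_one hl.ne']
  have hpow2 : ∀ l : ℝ, 0 < l → l ^ (2 - 2 * H) = l ^ (1 - 2 * H) * l := by
    intro l hl
    rw [show 2 - 2 * H = (1 - 2 * H) + 1 by ring, Real.rpow_add_one hl.ne']
  -- level 1
  have L1 : ∀ u v : ℝ, 0 ≤ u → 0 ≤ v → u ≠ v → (∫ r in (0:ℝ)..(min u v),
      ∑' j : ℤ, Real.exp (-(b * a ^ j * (u + v - 2 * r))) * (b * a ^ j) ^ (3 - 2 * H))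
      = ∑' j : ℤ, (b * a ^ j) ^ (2 - 2 * H) / 2 *
        (Real.exp (-(b * a ^ j * |u - v|)) - Real.exp (-(b * a ^ j * (u + v)))) := by
    intro u v hu hv huv
    have e : ∀ j : ℤ, (∫ r in (0:ℝ)..(min u v),
        Real.exp (-(b * a ^ j * (u + v - 2 * r))) * (b * a ^ j) ^ (3 - 2 * H))
        = (b * a ^ j) ^ (2 - 2 * H) / 2 *
        (Real.exp (-(b * a ^ j * |u - v|)) - Real.exp (-(b * a ^ j * (u + v)))) := by
      intro j
      have hlj := hl j
      rw [intervalIntegral.integral_mul_const, int1 _ hlj, hpow3 _ hlj]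
      field_simp
    rw [aux_swap (min u v) (le_min hu hv)]
    · exact tsum_congr e
    · intro j; fun_prop
    · intro j y _ _
      have := hl j
      positivity
    · simp only [e]
      have huv' : 0 < |u - v| := abs_pos.2 (sub_ne_zero.2 huv)
      apply aux_summable a b H ha0 ha1 hb hH1 hH2 (1 + 1 / |u - v|)
      · intro j
        have := hl j
        have := G_nonneg _ (hl j) u v hu hv
        positivity
      · intro j
        have hlj := hl j
        generalize b * a ^ j = l at hlj
        have h1 : Real.exp (-(l * |u - v|)) ≤ 1 := by
          rw [Real.exp_le_one_iff]; nlinarith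
        have h2 := Real.exp_pos (-(l * (u + v)))
        have h3 : 0 < l ^ (2 - 2 * H) := by positivity
        have h4 : 0 < 1 / |u - v| := by positivity
        rw [div_mul_eq_mul_div, mul_div_assoc, mul_comm]
        apply mul_le_mul_of_nonneg_right _ h3.le
        linarith
      · intro j
        have hlj := hl j
        generalize b * a ^ j = l at hlj
        have h1 := exp_le_inv_aux (l * |u - v|) (by positivity)
        have h2 := Real.exp_pos (-(l * (u + v)))
        have h3 : 0 < l ^ (1 - 2 * H) := by positivity
        have h4 : 0 < 1 / |u - v| := by positivity
        rw [hpow2 l hlj, div_mul_eq_mul_div, mul_div_assoc, mul_assoc, mul_comm]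
        apply mul_le_mul_of_nonneg_right _ h3.le
        have h5 : l * Real.exp (-(l * |u - v|)) ≤ 1 / |u - v| := by
          calc l * Real.exp (-(l * |u - v|)) ≤ l * (1 / (l * |u - v|)) := by gcongr
            _ = _ := by field_simp
        have := mul_pos hlj h2
        nlinarith [mul_pos hlj (Real.exp_pos (-(l * |u - v|)))]
  -- level 2
  have e2 : ∀ (v : ℝ) (j : ℤ), (∫ u in (0:ℝ)..s, (b * a ^ j) ^ (2 - 2 * H) / 2 *
        (Real.exp (-(b * a ^ j * |u - v|)) - Real.exp (-(b * a ^ j * (u + v)))))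
      = (b * a ^ j) ^ (2 - 2 * H) / 2 * (psiA (b * a ^ j) (s - v) + psiA (b * a ^ j) v
        - Real.exp (-(b * a ^ j * v)) * ((1 - Real.exp (-(b * a ^ j * s))) / (b * a ^ j))) := by
    intro v j
    rw [intervalIntegral.integral_const_mul, int2 _ (hl j)]
  have n2 : ∀ (l v : ℝ), 0 < l → 0 ≤ v → 0 ≤ psiA l (s - v) + psiA l v
        - Real.exp (-(l * v)) * ((1 - Real.exp (-(l * s))) / l) := by
    intro l v hl hv
    rw [← int2 l hl]
    exact intervalIntegral.integral_nonneg hs fun u hu => G_nonneg l hl u v hu.1 hv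
  have b21 : ∀ (l v : ℝ), 0 < l → 0 ≤ v → psiA l (s - v) + psiA l v
        - Real.exp (-(l * v)) * ((1 - Real.exp (-(l * s))) / l) ≤ s := by
    intro l v hl hv
    rw [← int2 l hl]
    have : s = ∫ u in (0:ℝ)..s, (1:ℝ) := by simp
    conv_rhs => rw [this]
    refine intervalIntegral.integral_mono_on hs ?_ (by simp) fun u hu => ?_
    · exact Continuous.intervalIntegrable (by fun_prop) _ _
    · have h1 : Real.exp (-(l * |u - v|)) ≤ 1 := by
        rw [Real.exp_le_one_iff]; nlinarith [abs_nonneg (u - v)]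
      linarith [Real.exp_pos (-(l * (u + v)))]
  have b22 : ∀ (l v : ℝ), 0 < l → 0 ≤ v → psiA l (s - v) + psiA l v
        - Real.exp (-(l * v)) * ((1 - Real.exp (-(l * s))) / l) ≤ 2 / l := by
    intro l v hl hv
    have h1 : Real.exp (-(l * s)) ≤ 1 := by
      rw [Real.exp_le_one_iff]; nlinarith
    have h2 : 0 ≤ Real.exp (-(l * v)) * ((1 - Real.exp (-(l * s))) / l) := by
      apply mul_nonneg (Real.exp_pos _).le (div_nonneg (by linarith) hl.le)
    have := psiA_le l hl (s - v)
    have := psiA_le l hl v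
    have : 2 / l = 1 / l + 1 / l := by ring
    linarith
  have c1 : ∀ (l v : ℝ), 0 < l → 0 ≤ v → l ^ (2 - 2 * H) / 2 * (psiA l (s - v) + psiA l v
        - Real.exp (-(l * v)) * ((1 - Real.exp (-(l * s))) / l))
        ≤ (1 + s) * l ^ (2 - 2 * H) := by
    intro l v hl hv
    have h3 : 0 < l ^ (2 - 2 * H) := by positivity
    rw [div_mul_eq_mul_div, mul_div_assoc, mul_comm]
    apply mul_le_mul_of_nonneg_right _ h3.le
    linarith [b21 l v hl hv]
  have c2 : ∀ (l v : ℝ), 0 < l → 0 ≤ v → l ^ (2 - 2 * H) / 2 * (psiA l (s - v) + psiA l v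
        - Real.exp (-(l * v)) * ((1 - Real.exp (-(l * s))) / l))
        ≤ (1 + s) * l ^ (1 - 2 * H) := by
    intro l v hl hv
    have h3 : 0 < l ^ (1 - 2 * H) := by positivity
    have h4 : l * (psiA l (s - v) + psiA l v
        - Real.exp (-(l * v)) * ((1 - Real.exp (-(l * s))) / l)) ≤ 2 := by
      have := b22 l v hl hv
      rw [le_div_iff₀ hl] at this
      linarith
    rw [hpow2 l hl, div_mul_eq_mul_div, mul_div_assoc, mul_assoc, mul_comm]
    apply mul_le_mul_of_nonneg_right _ h3.le
    linarith
  have L2 : ∀ v : ℝ, 0 ≤ v → (∫ u in (0:ℝ)..s, ∫ r in (0:ℝ)..(min u v),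
      ∑' j : ℤ, Real.exp (-(b * a ^ j * (u + v - 2 * r))) * (b * a ^ j) ^ (3 - 2 * H))
      = ∑' j : ℤ, (b * a ^ j) ^ (2 - 2 * H) / 2 * (psiA (b * a ^ j) (s - v) + psiA (b * a ^ j) v
        - Real.exp (-(b * a ^ j * v)) * ((1 - Real.exp (-(b * a ^ j * s))) / (b * a ^ j))) := by
    intro v hv
    have : (∫ u in (0:ℝ)..s, ∫ r in (0:ℝ)..(min u v),
      ∑' j : ℤ, Real.exp (-(b * a ^ j * (u + v - 2 * r))) * (b * a ^ j) ^ (3 - 2 * H))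
      = ∫ u in (0:ℝ)..s, ∑' j : ℤ, (b * a ^ j) ^ (2 - 2 * H) / 2 *
        (Real.exp (-(b * a ^ j * |u - v|)) - Real.exp (-(b * a ^ j * (u + v)))) := by
      apply intervalIntegral.integral_congr_ae
      have hne : ∀ᵐ u : ℝ, u ≠ v := by
        simp [MeasureTheory.ae_iff]
      filter_upwards [hne] with u hu hmem
      rw [Set.uIoc_of_le hs] at hmem
      exact L1 u v hmem.1.le hv hu
    rw [this, aux_swap s hs]
    · exact tsum_congr (e2 v)
    · intro j; fun_prop
    · intro j y hy _
      have := hl j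
      have := G_nonneg _ (hl j) y v hy.le hv
      positivity
    · simp only [e2]
      apply aux_summable a b H ha0 ha1 hb hH1 hH2 (1 + s)
      · intro j
        have := hl j
        have := n2 _ v (hl j) hv
        positivity
      · exact fun j => c1 _ v (hl j) hv
      · exact fun j => c2 _ v (hl j) hv
  -- level 3
  have e3 : ∀ (j : ℤ), (∫ v in (0:ℝ)..t, (b * a ^ j) ^ (2 - 2 * H) / 2 *
        (psiA (b * a ^ j) (s - v) + psiA (b * a ^ j) v
        - Real.exp (-(b * a ^ j * v)) * ((1 - Real.exp (-(b * a ^ j * s))) / (b * a ^ j))))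
      = (b * a ^ j) ^ (2 - 2 * H) * PhiA (b * a ^ j) s
        + (b * a ^ j) ^ (2 - 2 * H) * PhiA (b * a ^ j) t
        - (1 / 2) * ((b * a ^ j) ^ (2 - 2 * H) * PhiA (b * a ^ j) (s + t)
          + (b * a ^ j) ^ (2 - 2 * H) * PhiA (b * a ^ j) |s - t|) := by
    intro j
    have hlj := hl j
    rw [intervalIntegral.integral_const_mul, int3 _ hlj, PhiA_abs]
    generalize b * a ^ j = l at hlj
    rw [PhiA_nonneg_eq l hlj s hs, PhiA_nonneg_eq l hlj t ht,
      PhiA_nonneg_eq l hlj (s + t) (by linarith), mul_add l s t, neg_add, Real.exp_add]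
    field_simp
    ring
  have HS := ((hosc_sum a b H ha0 ha1 hb hH1 hH2 s hs).add
    (hosc_sum a b H ha0 ha1 hb hH1 hH2 t ht)).sub
    (((hosc_sum a b H ha0 ha1 hb hH1 hH2 (s + t) (by linarith)).add
    (hosc_sum a b H ha0 ha1 hb hH1 hH2 |s - t| (abs_nonneg _))).mul_left (1 / 2))
  have : (∫ v in (0:ℝ)..t, ∫ u in (0:ℝ)..s, ∫ r in (0:ℝ)..(min u v),
      ∑' j : ℤ, Real.exp (-(b * a ^ j * (u + v - 2 * r))) * (b * a ^ j) ^ (3 - 2 * H))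
      = ∫ v in (0:ℝ)..t, ∑' j : ℤ, (b * a ^ j) ^ (2 - 2 * H) / 2 *
        (psiA (b * a ^ j) (s - v) + psiA (b * a ^ j) v
        - Real.exp (-(b * a ^ j * v)) * ((1 - Real.exp (-(b * a ^ j * s))) / (b * a ^ j))) := by
    refine intervalIntegral.integral_congr fun v hv => ?_
    rw [Set.uIcc_of_le ht] at hv
    exact L2 v hv.1
  rw [this, aux_swap t ht]
  · rw [tsum_congr e3]
    exact HS.tsum_eq
  · intro j
    have := psiA_cont (b * a ^ j)
    fun_prop
  · intro j y hy _
    have := hl j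
    have := n2 _ y (hl j) hy.le
    positivity
  · simp only [e3]
    exact HS.summable
end

section
/- For every H in (1, 3/2) and all s, t ≥ 0, the onsfBm covariance has the representation Q̃_H(s,t) = (1/4) Σ_{j∈ℤ} ∫_ℝ ∫_ℝ (1_{[0,s]}(x) - 1_{[-s,0]}(x)) (1_{[0,t]}(y) - 1_{[-t,0]}(y)) (b a^j)^{2-2H} e^{-|x-y| b a^j} dx dy, where the sum over j is taken outside the double integral. -/
open Real MeasureTheory

/-- The oscillatory function
`h̃_t = Σ_{j∈ℤ} (b a^j t)^{-2H} (e^{-b a^j t} - 1 + b a^j t - (b a^j t)²/2)`. -/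
noncomputable def htil (a b H t : ℝ) : ℝ :=
  ∑' j : ℤ, (b * a ^ j * t) ^ (-(2 * H)) *
    (Real.exp (-(b * a ^ j * t)) - 1 + b * a ^ j * t - (b * a ^ j * t) ^ 2 / 2)

/-- The oscillatory negative sub-fractional Brownian motion covariance `Q̃_H(s,t)`. -/
noncomputable def Qtil (a b H s t : ℝ) : ℝ :=
  s ^ (2 * H) * htil a b H s + t ^ (2 * H) * htil a b H t
    - (1 / 2) * ((s + t) ^ (2 * H) * htil a b H (s + t)
      + |s - t| ^ (2 * H) * htil a b H |s - t|)

/-- first antiderivative of `e^{-c|u|}` -/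
noncomputable def gOne (c u : ℝ) : ℝ := ∫ v in (0:ℝ)..u, Real.exp (-(|v| * c))

/-- second antiderivative of `e^{-c|u|}` -/
noncomputable def gTwo (c u : ℝ) : ℝ := ∫ v in (0:ℝ)..u, gOne c v

lemma cont_e (c : ℝ) : Continuous (fun v : ℝ => Real.exp (-(|v| * c))) := by fun_prop

lemma gOne_deriv (c u : ℝ) : HasDerivAt (gOne c) (Real.exp (-(|u| * c))) u :=
  intervalIntegral.integral_hasDerivAt_right ((cont_e c).intervalIntegrable _ _)
    ((cont_e c).stronglyMeasurableAtFilter _ _) (cont_e c).continuousAt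

lemma gOne_cont (c : ℝ) : Continuous (gOne c) :=
  continuous_iff_continuousAt.2 fun u => (gOne_deriv c u).continuousAt

lemma gTwo_deriv (c u : ℝ) : HasDerivAt (gTwo c) (gOne c u) u :=
  intervalIntegral.integral_hasDerivAt_right ((gOne_cont c).intervalIntegrable _ _)
    ((gOne_cont c).stronglyMeasurableAtFilter _ _) (gOne_cont c).continuousAt

lemma gOne_neg (c u : ℝ) : gOne c (-u) = - gOne c u := by
  unfold gOne
  have := intervalIntegral.integral_comp_neg (a := 0) (b := u)
    (fun v : ℝ => Real.exp (-(|v| * c)))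
  simp only [abs_neg, neg_zero] at this
  rw [this, intervalIntegral.integral_symm]

lemma gTwo_neg (c u : ℝ) : gTwo c (-u) = gTwo c u := by
  unfold gTwo
  have := intervalIntegral.integral_comp_neg (a := 0) (b := u) (gOne c)
  simp only [gOne_neg, neg_zero, intervalIntegral.integral_neg] at this
  rw [intervalIntegral.integral_symm, ← this, neg_neg]

lemma gTwo_abs (c u : ℝ) : gTwo c |u| = gTwo c u := by
  rcases abs_choice u with h | h <;> rw [h]
  exact gTwo_neg c u

lemma gTwo_zero (c : ℝ) : gTwo c 0 = 0 := by simp [gTwo]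

lemma gOne_eq (c u : ℝ) (hc : 0 < c) (hu : 0 ≤ u) : gOne c u = (1 - Real.exp (-(u * c))) / c := by
  have h : gOne c u = ∫ v in (0:ℝ)..u, Real.exp (-(v * c)) := by
    unfold gOne
    apply intervalIntegral.integral_congr
    intro v hv
    rw [Set.uIcc_of_le hu] at hv
    simp only [abs_of_nonneg hv.1]
  rw [h, intervalIntegral.integral_eq_sub_of_hasDerivAt
    (f := fun v => - Real.exp (-(v * c)) / c)]
  · simp; field_simp; ring
  · intro x _
    have := ((((hasDerivAt_id x).mul_const c).neg).exp.neg).div_const c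
    refine this.congr_deriv ?_
    simp; field_simp
  · exact Continuous.intervalIntegrable (by fun_prop) _ _

lemma gTwo_eq (c u : ℝ) (hc : 0 < c) (hu : 0 ≤ u) :
    gTwo c u = (Real.exp (-(u * c)) - 1 + u * c) / c ^ 2 := by
  have h : gTwo c u = ∫ v in (0:ℝ)..u, (1 - Real.exp (-(v * c))) / c := by
    unfold gTwo
    apply intervalIntegral.integral_congr
    intro v hv
    rw [Set.uIcc_of_le hu] at hv
    exact gOne_eq c v hc hv.1
  rw [h, intervalIntegral.integral_eq_sub_of_hasDerivAt
    (f := fun v => (Real.exp (-(v * c)) + v * c) / c ^ 2)]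
  · simp; field_simp; ring
  · intro x _
    have := ((((hasDerivAt_id x).mul_const c).neg).exp.add
      ((hasDerivAt_id x).mul_const c)).div_const (c ^ 2)
    refine this.congr_deriv ?_
    simp; field_simp; ring
  · exact Continuous.intervalIntegrable (by fun_prop) _ _

lemma integral_phi (s : ℝ) (hs : 0 ≤ s) (f : ℝ → ℝ) (hf : Continuous f) :
    ∫ x : ℝ, ((Set.Icc (0:ℝ) s).indicator (fun _ => (1:ℝ)) x
        - (Set.Icc (-s) (0:ℝ)).indicator (fun _ => (1:ℝ)) x) * f x
      = ∫ x in (0:ℝ)..s, (f x - f (-x)) := by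
  have e : ∀ x, ((Set.Icc (0:ℝ) s).indicator (fun _ => (1:ℝ)) x
        - (Set.Icc (-s) (0:ℝ)).indicator (fun _ => (1:ℝ)) x) * f x
      = (Set.Icc (0:ℝ) s).indicator f x - (Set.Icc (-s) (0:ℝ)).indicator f x := by
    intro x
    simp only [Set.indicator_apply]
    split_ifs <;> ring
  simp_rw [e]
  rw [integral_sub, integral_indicator measurableSet_Icc, integral_indicator measurableSet_Icc,
    integral_Icc_eq_integral_Ioc, integral_Icc_eq_integral_Ioc,
    ← intervalIntegral.integral_of_le hs, ← intervalIntegral.integral_of_le (by linarith),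
    intervalIntegral.integral_sub (hf.intervalIntegrable _ _)
      (Continuous.intervalIntegrable (by fun_prop) _ _),
    intervalIntegral.integral_comp_neg, neg_zero]
  · exact (integrable_indicator_iff measurableSet_Icc).2 (hf.continuousOn.integrableOn_Icc)
  · exact (integrable_indicator_iff measurableSet_Icc).2 (hf.continuousOn.integrableOn_Icc)

lemma inner_eq (c s y : ℝ) :
    ∫ x in (0:ℝ)..s, (Real.exp (-(|x - y| * c)) - Real.exp (-(|-x - y| * c)))
      = gOne c (s - y) + 2 * gOne c y - gOne c (s + y) := by
  rw [intervalIntegral.integral_eq_sub_of_hasDerivAt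
    (f := fun x => gOne c (x - y) - gOne c (x + y))]
  · rw [zero_sub, gOne_neg, zero_add]; ring
  · intro x _
    have h1 := (gOne_deriv c (x - y)).comp_sub_const x y
    have h2 := (gOne_deriv c (x + y)).comp_add_const x y
    have := h1.sub h2
    have e : |-x - y| = |x + y| := by rw [← abs_neg]; congr 1; ring
    rw [e]; exact this
  · exact Continuous.intervalIntegrable (by fun_prop) _ _

lemma outer_eq (c s t : ℝ) :
    ∫ y in (0:ℝ)..t, ((gOne c (s - y) + 2 * gOne c y - gOne c (s + y))
       - (gOne c (s - -y) + 2 * gOne c (-y) - gOne c (s + -y)))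
      = 2 * (2 * gTwo c s + 2 * gTwo c t - gTwo c (s + t) - gTwo c (s - t)) := by
  have hc := gOne_cont c
  rw [intervalIntegral.integral_eq_sub_of_hasDerivAt
    (f := fun y => 2 * (- gTwo c (s - y) + 2 * gTwo c y - gTwo c (s + y)))]
  · simp only [sub_zero, add_zero, gTwo_zero]; ring
  · intro y _
    have h1 := (gTwo_deriv c (s - y)).comp_const_sub s y
    have h2 := (gTwo_deriv c (s + y)).comp_const_add s y
    have := ((h1.neg.add ((gTwo_deriv c y).const_mul 2)).sub h2).const_mul 2
    refine this.congr_deriv ?_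
    rw [gOne_neg, sub_neg_eq_add, ← sub_eq_add_neg]; ring
  · exact Continuous.intervalIntegrable (by fun_prop) _ _

lemma double_eq (c C s t : ℝ) (hs : 0 ≤ s) (ht : 0 ≤ t) :
    (∫ y : ℝ, ∫ x : ℝ,
      ((Set.Icc (0:ℝ) s).indicator (fun _ => (1:ℝ)) x
        - (Set.Icc (-s) (0:ℝ)).indicator (fun _ => (1:ℝ)) x) *
      ((Set.Icc (0:ℝ) t).indicator (fun _ => (1:ℝ)) y
        - (Set.Icc (-t) (0:ℝ)).indicator (fun _ => (1:ℝ)) y) *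
      (C * Real.exp (-(|x - y| * c))))
      = C * (2 * (2 * gTwo c s + 2 * gTwo c t - gTwo c (s + t) - gTwo c (s - t))) := by
  have hc := gOne_cont c
  rw [← outer_eq, ← integral_phi t ht
    (fun y => gOne c (s - y) + 2 * gOne c y - gOne c (s + y)) (by fun_prop),
    ← integral_const_mul]
  congr 1
  funext y
  rw [← inner_eq, ← integral_phi s hs (fun x => Real.exp (-(|x - y| * c))) (by fun_prop),
    ← integral_const_mul, ← integral_const_mul]
  congr 1
  funext x
  ring

lemma gg_bound2 (u : ℝ) (hu : 0 ≤ u) :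
    |Real.exp (-u) - 1 + u - u ^ 2 / 2| ≤ u ^ 2 := by
  have h1 : 1 - u ≤ Real.exp (-u) := by have := Real.add_one_le_exp (-u); linarith
  have h2 : Real.exp (-u) ≤ 1 - u + u ^ 2 / 2 := by
    have h3 := Real.quadratic_le_exp_of_nonneg hu
    rw [Real.exp_neg]
    apply inv_le_of_inv_le₀ (by nlinarith [sq_nonneg (u - 1)])
    refine le_trans ?_ h3
    rw [inv_le_iff_one_le_mul₀ (by nlinarith [sq_nonneg (u - 1)])]
    nlinarith [sq_nonneg (u ^ 2)]
  rw [abs_le]; constructor <;> nlinarith [sq_nonneg u]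

lemma gg_bound3 (u : ℝ) (hu : 0 ≤ u) :
    |Real.exp (-u) - 1 + u - u ^ 2 / 2| ≤ u ^ 3 := by
  by_cases h : 1 ≤ u
  · refine (gg_bound2 u hu).trans ?_
    nlinarith [sq_nonneg u]
  · push Not at h
    have := Real.exp_bound (x := -u) (by rw [abs_neg, abs_of_nonneg hu]; exact h.le)
      (n := 3) (by norm_num)
    simp [Finset.sum_range_succ, Nat.factorial, abs_of_nonneg hu] at this
    have e : Real.exp (-u) - 1 + u - u ^ 2 / 2 = Real.exp (-u) - (1 + -u + u ^ 2 / 2) := by ring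
    rw [e]
    refine this.trans ?_
    have : 0 ≤ u ^ 3 := by positivity
    norm_num
    linarith

lemma term_summable (a b : ℝ) (ha0 : 0 < a) (ha1 : a < 1) (hb : 0 < b)
    (H : ℝ) (hH1 : 1 < H) (hH2 : H < 3 / 2) (t : ℝ) (ht : 0 ≤ t) :
    Summable (fun j : ℤ => (b * a ^ j) ^ (-(2 * H)) *
      (Real.exp (-(b * a ^ j * t)) - 1 + b * a ^ j * t - (b * a ^ j * t) ^ 2 / 2)) := by
  have key : ∀ c : ℝ, 0 < c → ∀ n : ℕ,
      |Real.exp (-(c * t)) - 1 + c * t - (c * t) ^ 2 / 2| ≤ (c * t) ^ n →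
      ‖c ^ (-(2 * H)) * (Real.exp (-(c * t)) - 1 + c * t - (c * t) ^ 2 / 2)‖
        ≤ t ^ n * c ^ ((n:ℝ) - 2 * H) := by
    intro c hc n h
    rw [norm_mul, Real.norm_of_nonneg (by positivity), Real.norm_eq_abs]
    calc _ ≤ c ^ (-(2 * H)) * (c * t) ^ n := by gcongr
      _ = _ := by
        rw [sub_eq_add_neg, Real.rpow_add hc, Real.rpow_natCast, mul_pow]; ring
  apply Summable.of_nat_of_neg
  · have hr1 : a ^ ((3:ℝ) - 2 * H) < 1 := Real.rpow_lt_one ha0.le ha1 (by linarith)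
    have hg := (summable_geometric_of_lt_one (by positivity) hr1).mul_left
      (t ^ 3 * b ^ ((3:ℝ) - 2 * H))
    refine Summable.of_norm_bounded hg fun n => ?_
    have hc : 0 < b * a ^ (n:ℤ) := by positivity
    refine (key _ hc 3 (gg_bound3 _ (by positivity))).trans (le_of_eq ?_)
    push_cast
    rw [Real.mul_rpow hb.le (by positivity), zpow_natCast, ← Real.rpow_natCast a,
      ← Real.rpow_natCast (a ^ _), ← Real.rpow_mul ha0.le, ← Real.rpow_mul ha0.le]
    ring_nf
  · have hr1 : a ^ (2 * H - 2) < 1 := Real.rpow_lt_one ha0.le ha1 (by linarith)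
    have hg := (summable_geometric_of_lt_one (by positivity) hr1).mul_left
      (t ^ 2 * b ^ ((2:ℝ) - 2 * H))
    refine Summable.of_norm_bounded hg fun n => ?_
    have hc : 0 < b * a ^ (-(n:ℤ)) := by positivity
    refine (key _ hc 2 (gg_bound2 _ (by positivity))).trans (le_of_eq ?_)
    push_cast
    rw [Real.mul_rpow hb.le (by positivity), zpow_neg, zpow_natCast, ← Real.rpow_natCast a,
      ← Real.rpow_neg ha0.le,
      ← Real.rpow_natCast (a ^ _), ← Real.rpow_mul ha0.le, ← Real.rpow_mul ha0.le]
    ring_nf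

lemma htil_eq (a b : ℝ) (ha0 : 0 < a) (hb : 0 < b)
    (H : ℝ) (hH1 : 1 < H) (t : ℝ) (ht : 0 ≤ t) :
    t ^ (2 * H) * htil a b H t = ∑' j : ℤ, (b * a ^ j) ^ (-(2 * H)) *
      (Real.exp (-(b * a ^ j * t)) - 1 + b * a ^ j * t - (b * a ^ j * t) ^ 2 / 2) := by
  unfold htil
  rw [← tsum_mul_left]
  congr 1
  funext j
  rcases ht.eq_or_lt with rfl | h
  · simp
  · have hc : 0 < b * a ^ j := by positivity
    rw [Real.mul_rpow hc.le h.le, ← mul_assoc, mul_left_comm, ← Real.rpow_add h]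
    simp

theorem stmt12 (a b : ℝ) (ha0 : 0 < a) (ha1 : a < 1) (hb : 0 < b)
    (H : ℝ) (hH1 : 1 < H) (hH2 : H < 3 / 2) (s t : ℝ) (hs : 0 ≤ s) (ht : 0 ≤ t) :
    Qtil a b H s t = (1 / 4) * ∑' j : ℤ, ∫ y : ℝ, ∫ x : ℝ,
      ((Set.Icc (0:ℝ) s).indicator (fun _ => (1:ℝ)) x
        - (Set.Icc (-s) (0:ℝ)).indicator (fun _ => (1:ℝ)) x) *
      ((Set.Icc (0:ℝ) t).indicator (fun _ => (1:ℝ)) y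
        - (Set.Icc (-t) (0:ℝ)).indicator (fun _ => (1:ℝ)) y) *
      ((b * a ^ j) ^ (2 - 2 * H) * Real.exp (-(|x - y| * (b * a ^ j)))) := by
  have S := fun u hu => term_summable a b ha0 ha1 hb H hH1 hH2 u hu
  unfold Qtil
  rw [htil_eq a b ha0 hb H hH1 s hs, htil_eq a b ha0 hb H hH1 t ht,
    htil_eq a b ha0 hb H hH1 (s + t) (by positivity),
    htil_eq a b ha0 hb H hH1 |s - t| (abs_nonneg _)]
  have S1 := S s hs
  have S2 := S t ht
  have S3 := S (s + t) (by positivity)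
  have S4 := S |s - t| (abs_nonneg _)
  rw [← S1.tsum_add S2, ← S3.tsum_add S4, ← tsum_mul_left, ← tsum_mul_left,
    ← (S1.add S2).tsum_sub ((S3.add S4).mul_left _)]
  congr 1
  funext j
  have hc : 0 < b * a ^ j := by positivity
  rw [double_eq _ _ s t hs ht]
  generalize b * a ^ j = c at hc
  rw [← gTwo_abs c (s - t), gTwo_eq c s hc hs, gTwo_eq c t hc ht,
    gTwo_eq c (s + t) hc (by positivity), gTwo_eq c |s - t| hc (abs_nonneg _),
    sub_eq_add_neg (2:ℝ), Real.rpow_add hc, mul_comm s c, mul_comm t c, mul_comm (s + t) c,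
    mul_comm |s - t| c, mul_pow c |s - t|, sq_abs]
  have : c ^ (2:ℝ) = c ^ 2 := by norm_cast
  rw [this]
  field_simp
  ring
end
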